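/- Assume the conclusions of Propositions 1–6 hold for all k ≤ l. Then L(v_i^l) = L(c_i^l) for each i, and L(d_j^l) = L(w_j^l) for each j. -/

import Mathlib

/-!
Abstract framework for the paper "Stabilizations of reducible Heegaard splittings"
(R. Qiu).  All objects live inside an ambient topological space `X` (a surface for
the 2-dimensional statements, or an ambient space containing the 3-manifold and the
capping balls for the 3-dimensional ones).  The standard low-dimensional notions
(arcs, disks, cores of bands, compression bodies, …) are collected as primitives in
the structure `GeomPrim`.
-/

open Set

/-- `C` is a connected component of the subset `S` of a topological space. -/
def IsCompOf {X : Type*} [TopologicalSpace X] (C S : Set X) : Prop :=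
  ∃ x ∈ S, C = connectedComponentIn S x

/-- Primitive geometric notions about arcs, disks, bands, surfaces and compression
bodies inside an ambient space `X`. -/
structure GeomPrim (X : Type*) [TopologicalSpace X] where
  /-- `D` is an embedded closed disk. -/
  IsDisk : Set X → Prop
  /-- `a` is an embedded closed arc. -/
  IsArc : Set X → Prop
  /-- `S` is a 2-manifold, possibly with boundary. -/
  IsSurface : Set X → Prop
  /-- the manifold boundary of an arc, disk or surface. -/
  bd : Set X → Set X
  /-- the manifold interior of an arc, disk or surface. -/
  intr : Set X → Set X
  /-- the initial endpoint `∂₁` of an oriented arc. -/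
  ept1 : Set X → X
  /-- the terminal endpoint `∂₂` of an oriented arc. -/
  ept2 : Set X → X
  /-- `IsCore N c` : `c` is a core of the band `N = e × I`, i.e. a section
  `e × {t}` with `t ∈ (0,1)`. -/
  IsCore : Set X → Set X → Prop
  /-- `subProd N c` : for an arc `c` transversal to the fibres of the band `N`,
  the induced sub-product `(c × I)` of the band `N` over `c`. -/
  subProd : Set X → Set X → Set X
  /-- `bdProd N` : the set `(∂e) × I`, the two vertical end fibres of a band
  `N = e × I`. -/
  bdProd : Set X → Set X
  /-- `openBand N` : the set `e × (0,1)`, the open part of a band `N = e × I`. -/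
  openBand : Set X → Set X
  /-- `ProperArcIn S a` : `a` is a properly embedded arc in the surface `S`. -/
  ProperArcIn : Set X → Set X → Prop
  /-- `IsBandNbhd e N` : `N` is a product regular neighborhood `e × I` of the arc
  `e` (with `e = e × {0}`). -/
  IsBandNbhd : Set X → Set X → Prop
  /-- `IsAbstractTree P k e ml` : pushing the interiors of the arcs `e γ`, `γ ∈ ml`,
  off the disks `P 0, …, P k`, every component of the resulting complex, with the
  disks as fat vertices and the pushed arcs as edges, is a tree. -/
  IsAbstractTree : (ℕ → Set X) → ℕ → (ℕ → Set X) → Finset ℕ → Prop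
  /-- `C` is a compression body. -/
  IsCompressionBody : Set X → Prop
  /-- the positive boundary `∂₊` of a compression body. -/
  plusBd : Set X → Set X
  /-- `ProperDiskIn C D` : `D` is a properly embedded disk in the 3-manifold `C`. -/
  ProperDiskIn : Set X → Set X → Prop
  /-- `EssentialDiskIn C D` : `D` is an essential disk in the compression body `C`. -/
  EssentialDiskIn : Set X → Set X → Prop
  /-- the two disks intersect transversely in exactly one point. -/
  MeetTransverselyOnce : Set X → Set X → Prop

variable {X : Type*} [TopologicalSpace X]

/-- An abstract tree (Definition 2.1.2) of pairwise disjoint disks `P 0, …, P k`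
(fat vertices) and pairwise disjoint arcs `e γ`, `γ ∈ ml ⊆ {1,…,n}`, with
`∂(e γ) ⊆ ∪_f ∂(P f)`, together with chosen regular band neighborhoods
`band γ = e γ × I` of the arcs. -/
structure TreeConfig (X : Type*) [TopologicalSpace X] (G : GeomPrim X) where
  k : ℕ
  n : ℕ
  ml : Finset ℕ
  ml_sub : ml ⊆ Finset.Icc 1 n
  P : ℕ → Set X
  e : ℕ → Set X
  band : ℕ → Set X
  P_disk : ∀ f ≤ k, G.IsDisk (P f)
  P_disj : ∀ f ≤ k, ∀ f' ≤ k, f ≠ f' → Disjoint (P f) (P f')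
  e_arc : ∀ γ ∈ ml, G.IsArc (e γ)
  e_disj : ∀ γ ∈ ml, ∀ δ ∈ ml, γ ≠ δ → Disjoint (e γ) (e δ)
  e_bd : ∀ γ ∈ ml, G.bd (e γ) ⊆ ⋃ f ∈ Finset.range (k + 1), G.bd (P f)
  band_nbhd : ∀ γ ∈ ml, G.IsBandNbhd (e γ) (band γ)
  tree : G.IsAbstractTree P k e ml

namespace TreeConfig

variable {G : GeomPrim X}

/-- the union `∪_f P_f` of the fat-vertex disks. -/
def disks (T : TreeConfig X G) : Set X := ⋃ f ∈ Finset.range (T.k + 1), T.P f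

/-- `(int e_γ) × I`, the band minus its two vertical end fibres. -/
def innerBand (T : TreeConfig X G) (γ : ℕ) : Set X := T.band γ \ G.bdProd (T.band γ)

/-- `∪_f P_f ∪_{γ < l} e_γ × I`. -/
def below (T : TreeConfig X G) (l : ℕ) : Set X :=
  T.disks ∪ ⋃ γ ∈ T.ml.filter (· < l), T.band γ

/-- `S = ∪_f P_f ∪_{γ ∈ m(l)} e_γ × I`. -/
def total (T : TreeConfig X G) : Set X := T.disks ∪ ⋃ γ ∈ T.ml, T.band γ

/-- Condition (1*) : if `λ > γ` in `m(l)`, then either `e_λ ∩ e_γ × I = ∅` or each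
component of `e_λ ∩ e_γ × I` is an arc `c ⊆ int e_λ` which is a core of
`e_γ × (0,1)`, and each component of `e_λ × I ∩ e_γ × I` is `(c × I)_λ ⊆ e_γ × (0,1)`. -/
def Cond1 (T : TreeConfig X G) : Prop :=
  ∀ γ ∈ T.ml, ∀ l ∈ T.ml, γ < l →
    Disjoint (T.e l) (T.band γ) ∨
      ((∀ C : Set X, IsCompOf C (T.e l ∩ T.band γ) →
          C ⊆ G.intr (T.e l) ∧ G.IsCore (T.band γ) C) ∧
        (∀ C : Set X, IsCompOf C (T.band l ∩ T.band γ) →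
          ∃ c : Set X, C = G.subProd (T.band l) c ∧ G.IsCore (T.band γ) c ∧
            C ⊆ G.openBand (T.band γ)))

/-- Condition (2*) : each component of `(int e_λ) × I ∩ (∪_f P_f ∪_{γ<λ} e_γ × I)` is
`(b × I)_λ` where `b ⊆ int e_λ` is a properly embedded arc in
`∪_f P_f ∪_{γ<λ} e_γ × I`. -/
def Cond2 (T : TreeConfig X G) : Prop :=
  ∀ l ∈ T.ml, ∀ C : Set X, IsCompOf C (T.innerBand l ∩ T.below l) →
    ∃ b : Set X, b ⊆ G.intr (T.e l) ∧ G.ProperArcIn (T.below l) b ∧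
      C = G.subProd (T.band l) b

/-- Condition (3*) : for `γ ∈ m(l)`, `(∂e_γ) × I ⊆ ∪_f ∂P_f`, and for `λ ≠ γ` in
`m(l)`, `(∂e_γ) × I ∩ (∂e_λ) × I = ∅`. -/
def Cond3 (T : TreeConfig X G) : Prop :=
  (∀ γ ∈ T.ml, G.bdProd (T.band γ) ⊆ ⋃ f ∈ Finset.range (T.k + 1), G.bd (T.P f)) ∧
    ∀ γ ∈ T.ml, ∀ l ∈ T.ml, γ ≠ l →
      Disjoint (G.bdProd (T.band γ)) (G.bdProd (T.band l))

/-- `T.total` is the surface generated by the abstract tree (Definition 2.1.4). -/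
def Generates (T : TreeConfig X G) : Prop := T.Cond1 ∧ T.Cond2 ∧ T.Cond3

/-- `a` is regular (Definition 2.1.5) with respect to the bands with indices in `s` :
`a` is a properly embedded arc such that each component of `a ∩ (e_γ × I)` is a core
of `e_γ × (0,1)` contained in `int a`, each component of `a ∩ ∪_γ e_γ × I` is a core
of some `e_λ × (0,1)`, and for each `λ` there is at most one such component. -/
def RegularIn (T : TreeConfig X G) (s : Finset ℕ) (a : Set X) : Prop :=
  G.ProperArcIn (T.disks ∪ ⋃ γ ∈ s, T.band γ) a ∧
  (∀ γ ∈ s, ∀ C : Set X, IsCompOf C (a ∩ T.band γ) →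
      G.IsCore (T.band γ) C ∧ C ⊆ G.intr a) ∧
  (∀ C : Set X, IsCompOf C (a ∩ ⋃ γ ∈ s, T.band γ) →
      ∃ l ∈ s, G.IsCore (T.band l) C) ∧
  ∀ l ∈ s,
    {C : Set X | IsCompOf C (a ∩ ⋃ γ ∈ s, T.band γ) ∧ G.IsCore (T.band l) C}.Subsingleton

/-- `a` is a regular arc in the surface generated by the abstract tree. -/
def IsRegular (T : TreeConfig X G) (a : Set X) : Prop := T.RegularIn T.ml a

end TreeConfig

/-- The configuration of Section 2.2 of the paper (Assumption (*)) : a stabilized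
connected sum `𝒱 ∪ 𝒲` of two unstabilized Heegaard splittings `𝒱₊ ∪ 𝒲₊` and
`𝒱₋ ∪ 𝒲₋`, with reducing disks `B_𝒱, B_𝒲`, capping balls `H³₊, H³₋`, stabilizing
disks `V, W` meeting in the single point `x ∈ ∂₊𝒱₊ − B_𝒱`, the numbered arcs
`v₁,…,v_m` of `V ∩ B_𝒱` and `w₁,…,w_n` of `W ∩ B_𝒲`, the associated disks `V_i`,
`W_j` with their signs, the components `V_x`, `W_x` containing `x`, and the arcs
`w_{j,v}` with the disks `W_{j,±}` in the capping balls. -/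
structure GordonSetup (X : Type*) [TopologicalSpace X] (G : GeomPrim X) where
  /-- the compression bodies `𝒱`, `𝒲` of the stabilized splitting -/
  Vbody : Set X
  Wbody : Set X
  /-- the compression bodies of the factor splittings -/
  Vp : Set X
  Wp : Set X
  Vm : Set X
  Wm : Set X
  /-- the pieces `𝒲₊*`, `𝒲₋*` of `𝒲` cut along `B_𝒲` -/
  Wps : Set X
  Wms : Set X
  /-- the reducing disks -/
  BV : Set X
  BW : Set X
  /-- the capping 3-balls `H³₊`, `H³₋` -/
  Hp : Set X
  Hm : Set X
  /-- the stabilizing disks `V`, `W` -/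
  Vd : Set X
  Wd : Set X
  /-- the intersection point `x` -/
  x : X
  m : ℕ
  n : ℕ
  hm : 1 ≤ m
  hn : 1 ≤ n
  compVp : G.IsCompressionBody Vp
  compWp : G.IsCompressionBody Wp
  compVm : G.IsCompressionBody Vm
  compWm : G.IsCompressionBody Wm
  essBV : G.EssentialDiskIn Vbody BV
  essBW : G.EssentialDiskIn Wbody BW
  bdBV_eq : G.bd BV = G.bd BW
  properVd : G.ProperDiskIn Vbody Vd
  properWd : G.ProperDiskIn Wbody Wd
  meet_x : Vd ∩ Wd = {x}
  x_mem : x ∈ G.plusBd Vp \ BV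
  /-- `𝒱₊ ∪ 𝒲₊` is unstabilized -/
  unstab_p : ¬ ∃ D E : Set X, G.ProperDiskIn Vp D ∧ G.ProperDiskIn Wp E ∧
      G.MeetTransverselyOnce D E
  /-- `𝒱₋ ∪ 𝒲₋` is unstabilized -/
  unstab_m : ¬ ∃ D E : Set X, G.ProperDiskIn Vm D ∧ G.ProperDiskIn Wm E ∧
      G.MeetTransverselyOnce D E
  /-- the arcs `v_i` of `V ∩ B_𝒱` and `w_j` of `W ∩ B_𝒲` -/
  v : ℕ → Set X
  w : ℕ → Set X
  v_comp : ∀ i ∈ Finset.Icc 1 m, IsCompOf (v i) (Vd ∩ BV)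
  v_surj : ∀ C : Set X, IsCompOf C (Vd ∩ BV) → ∃ i ∈ Finset.Icc 1 m, C = v i
  v_inj : ∀ i ∈ Finset.Icc 1 m, ∀ i' ∈ Finset.Icc 1 m, v i = v i' → i = i'
  v_arc : ∀ i ∈ Finset.Icc 1 m, G.IsArc (v i)
  w_comp : ∀ j ∈ Finset.Icc 1 n, IsCompOf (w j) (Wd ∩ BW)
  w_surj : ∀ C : Set X, IsCompOf C (Wd ∩ BW) → ∃ j ∈ Finset.Icc 1 n, C = w j
  w_inj : ∀ j ∈ Finset.Icc 1 n, ∀ j' ∈ Finset.Icc 1 n, w j = w j' → j = j'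
  w_arc : ∀ j ∈ Finset.Icc 1 n, G.IsArc (w j)
  /-- `V′_{v_i}` (containing `x`) and `V″_{v_i}`, the two disks into which `v_i`
  separates `V` -/
  Vone : ℕ → Set X
  Vtwo : ℕ → Set X
  Vsplit : ∀ i ∈ Finset.Icc 1 m, G.IsDisk (Vone i) ∧ G.IsDisk (Vtwo i) ∧
      Vone i ∪ Vtwo i = Vd ∧ Vone i ∩ Vtwo i = v i ∧ x ∈ Vone i
  /-- `W′_{w_j}` and `W″_{w_j}` -/
  Wone : ℕ → Set X
  Wtwo : ℕ → Set X
  Wsplit : ∀ j ∈ Finset.Icc 1 n, G.IsDisk (Wone j) ∧ G.IsDisk (Wtwo j) ∧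
      Wone j ∪ Wtwo j = Wd ∧ Wone j ∩ Wtwo j = w j ∧ x ∈ Wone j
  /-- the numbering : inner disks get smaller indices -/
  v_order : ∀ i ∈ Finset.Icc 1 m, ∀ i' ∈ Finset.Icc 1 m, Vtwo i ⊂ Vtwo i' → i < i'
  w_order : ∀ j ∈ Finset.Icc 1 n, ∀ j' ∈ Finset.Icc 1 n, Wtwo j ⊂ Wtwo j' → j < j'
  /-- the disks `V_i` -/
  VD : ℕ → Set X
  /-- the disks `W_j` -/
  WD : ℕ → Set X
  VD_spec : ∀ i ∈ Finset.Icc 1 m, G.IsDisk (VD i) ∧ VD i ⊆ Vtwo i ∧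
      v i ⊆ G.bd (VD i) ∧ Disjoint (G.intr (VD i)) BV ∧
      ((G.ProperDiskIn Vp (VD i) ∧ VD i ⊆ Vp) ∨ (G.ProperDiskIn Vm (VD i) ∧ VD i ⊆ Vm))
  WD_spec : ∀ j ∈ Finset.Icc 1 n, G.IsDisk (WD j) ∧ WD j ⊆ Wtwo j ∧
      w j ⊆ G.bd (WD j) ∧ Disjoint (G.intr (WD j)) BW ∧
      ((G.ProperDiskIn Wps (WD j) ∧ WD j ⊆ Wps) ∨ (G.ProperDiskIn Wms (WD j) ∧ WD j ⊆ Wms))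
  /-- the signs `s(v_i)`, `s(w_j)` (`true` = `+`, `false` = `−`) -/
  sv : ℕ → Bool
  sw : ℕ → Bool
  sv_spec : ∀ i ∈ Finset.Icc 1 m, (sv i = true ↔ VD i ⊆ Vp) ∧ (sv i = false ↔ VD i ⊆ Vm)
  sw_spec : ∀ j ∈ Finset.Icc 1 n, (sw j = true ↔ WD j ⊆ Wps) ∧ (sw j = false ↔ WD j ⊆ Wms)
  /-- the component `V_x` of `V ∩ 𝒱₊` containing `x` -/
  Vx : Set X
  /-- the component `W_x` of `W ∩ 𝒲₊*` containing `x` -/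
  Wx : Set X
  Vx_spec : IsCompOf Vx (Vd ∩ Vp) ∧ x ∈ Vx
  Wx_spec : IsCompOf Wx (Wd ∩ Wps) ∧ x ∈ Wx
  /-- the arcs `w_{j,v} ⊆ B_𝒱` -/
  wv : ℕ → Set X
  /-- the disks `W_{j,+} ⊆ H³₊` -/
  WJp : ℕ → Set X
  /-- the disks `W_{j,−} ⊆ H³₋` -/
  WJm : ℕ → Set X
  wv_spec : ∀ j ∈ Finset.Icc 1 n, wv j ⊆ BV ∧ G.IsArc (wv j) ∧
      G.IsDisk (WJp j) ∧ WJp j ⊆ Hp ∧ G.bd (WJp j) = wv j ∪ w j ∧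
      G.IsDisk (WJm j) ∧ WJm j ⊆ Hm ∧ G.bd (WJm j) = wv j ∪ w j
  WJ_disj : ∀ j ∈ Finset.Icc 1 n, ∀ j' ∈ Finset.Icc 1 n, j ≠ j' →
      Disjoint (WJp j) (WJp j') ∧ Disjoint (WJm j) (WJm j')

namespace GordonSetup

variable {G : GeomPrim X}

/-- `I(v_i) = { r | v_r ≠ v_i, v_r ⊆ ∂V_i }`. -/
def Iv (S : GordonSetup X G) (i : ℕ) : Set ℕ :=
  {r | r ∈ Finset.Icc 1 S.m ∧ S.v r ≠ S.v i ∧ S.v r ⊆ G.bd (S.VD i)}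

/-- `I(w_j) = { r | w_r ≠ w_j, w_r ⊆ ∂W_j }`. -/
def Iw (S : GordonSetup X G) (j : ℕ) : Set ℕ :=
  {r | r ∈ Finset.Icc 1 S.n ∧ S.w r ≠ S.w j ∧ S.w r ⊆ G.bd (S.WD j)}

/-- `I(v) = { r | v_r ⊆ V_x ∩ B_𝒱 }`. -/
def Ivx (S : GordonSetup X G) : Set ℕ :=
  {r | r ∈ Finset.Icc 1 S.m ∧ S.v r ⊆ S.Vx ∩ S.BV}

/-- `I(w) = { r | w_r ⊆ W_x ∩ B_𝒲 }`. -/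
def Iwx (S : GordonSetup X G) : Set ℕ :=
  {r | r ∈ Finset.Icc 1 S.n ∧ S.w r ⊆ S.Wx ∩ S.BW}

/-- `I(v_i, k) = I(v_i) − {1,…,k}`. -/
def IvS (S : GordonSetup X G) (i k : ℕ) : Set ℕ := {r | r ∈ S.Iv i ∧ k < r}

/-- `I(w_j, k) = I(w_j) − m(k)`, for `m(k) = mk`. -/
def IwS (S : GordonSetup X G) (j : ℕ) (mk : Finset ℕ) : Set ℕ :=
  {r | r ∈ S.Iw j ∧ r ∉ mk}

/-- `I(v, k) = I(v) − {1,…,k}`. -/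
def IvxS (S : GordonSetup X G) (k : ℕ) : Set ℕ := {r | r ∈ S.Ivx ∧ k < r}

/-- `I(w, k) = I(w) − m(k)`, for `m(k) = mk`. -/
def IwxS (S : GordonSetup X G) (mk : Finset ℕ) : Set ℕ := {r | r ∈ S.Iwx ∧ r ∉ mk}

/-- `W_{j,v} = W_j ∪ W_{j,±} ∪_{r ∈ I(w_j)} W_{r,±}`, the sign according to `s(w_j)`. -/
def WV (S : GordonSetup X G) (j : ℕ) : Set X :=
  if S.sw j = true then S.WD j ∪ S.WJp j ∪ ⋃ r ∈ S.Iw j, S.WJp r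
  else S.WD j ∪ S.WJm j ∪ ⋃ r ∈ S.Iw j, S.WJm r

/-- `W_{x,v} = W_x ∪_{r ∈ I(w)} W_{r,+}`. -/
def WxV (S : GordonSetup X G) : Set X := S.Wx ∪ ⋃ r ∈ S.Iwx, S.WJp r

end GordonSetup

/-- The data and conditions of **Proposition 1** at stage `k` : a surface
`P^k ⊆ ∂₊𝒱₊` generated by an abstract tree `∪_f D_f^k ∪_{γ ∈ m(k)} b_γ^k`
(with `m(k) ⊆ {1,…,n}`), together with the pairwise disjoint arcs `v_i^k`
(`k+1 ≤ i ≤ m`) and `w_j^k` (`j ∈ {1,…,n} − m(k)`) in `P^k` satisfying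
conditions (1)–(5) of Proposition 1. -/
structure Prop1Data {X : Type*} [TopologicalSpace X] (G : GeomPrim X)
    (S : GordonSetup X G) (k : ℕ) where
  /-- the abstract tree `∪_f D_f^k ∪_{γ∈m(k)} b_γ^k` with `m(k) = T.ml`,
  whose generated surface is `P^k = T.total` -/
  T : TreeConfig X G
  hk : T.k = k
  hn : T.n = S.n
  card_le : T.ml.card ≤ k
  gen : T.Generates
  sub : T.total ⊆ G.plusBd S.Vp
  /-- the arcs `v_i^k` -/
  va : ℕ → Set X
  /-- the arcs `w_j^k` -/
  wa : ℕ → Set X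
  va_sub : ∀ i : ℕ, k + 1 ≤ i → i ≤ S.m → va i ⊆ T.total
  wa_sub : ∀ j ∈ Finset.Icc 1 S.n, j ∉ T.ml → wa j ⊆ T.total
  va_disj : ∀ i : ℕ, k + 1 ≤ i → i ≤ S.m → ∀ i' : ℕ, k + 1 ≤ i' → i' ≤ S.m →
      i ≠ i' → Disjoint (va i) (va i')
  wa_disj : ∀ j ∈ Finset.Icc 1 S.n, j ∉ T.ml → ∀ j' ∈ Finset.Icc 1 S.n, j' ∉ T.ml →
      j ≠ j' → Disjoint (wa j) (wa j')
  /-- condition (1)(i) : for `λ ∈ m(k)` with `s(w_λ) = +`,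
  `(int b_λ^k × I) ∩ (∪_{γ<λ} b_γ^k × I ∪_f D_f^k) = ∪_{r ∈ I(w_λ,k)} (w_r^k × I)_λ` -/
  cond_i : ∀ l ∈ T.ml, S.sw l = true →
      T.innerBand l ∩ T.below l = ⋃ r ∈ S.IwS l T.ml, G.subProd (T.band l) (wa r)
  /-- condition (1)(ii) : for `λ ∈ m(k)` with `s(w_λ) = −`, `int b_λ^k × I` is
  disjoint from `∪_f D_f^k ∪_{γ<λ} b_γ^k × I` -/
  cond_ii : ∀ l ∈ T.ml, S.sw l = false → Disjoint (T.innerBand l) (T.below l)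
  /-- condition (2) : `w_j^k` is regular in `∪_{γ<j} b_γ^k × I ∪_f D_f^k` -/
  cond2 : ∀ j ∈ Finset.Icc 1 S.n, j ∉ T.ml → T.RegularIn (T.ml.filter (· < j)) (wa j)
  /-- condition (3) -/
  cond3 : ∀ j ∈ Finset.Icc 1 S.n, j ∉ T.ml → ∀ γ ∈ T.ml, j < γ →
      (j ∈ S.IwS γ T.ml ∧ S.sw γ = true) ∨ Disjoint (wa j) (T.band γ)
  /-- condition (4), first part : `v_i^k` is a properly embedded arc in `P^k` lying
  in `D_f^k` for some `f` -/
  cond4 : ∀ i : ℕ, k + 1 ≤ i → i ≤ S.m →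
      G.ProperArcIn T.total (va i) ∧ ∃ f ≤ T.k, va i ⊆ T.P f
  /-- condition (4), second part : `w_j^k − ∪_{γ<j} int b_γ^k × I` intersects `v_i^k`
  in at most one point -/
  cond4' : ∀ i : ℕ, k + 1 ≤ i → i ≤ S.m → ∀ j ∈ Finset.Icc 1 S.n, j ∉ T.ml →
      ((wa j \ ⋃ γ ∈ T.ml.filter (· < j), T.innerBand γ) ∩ va i).Subsingleton
  /-- condition (5) : `∂v_i^k ∩ w_j^k = ∅` and `∂v_i^k ∩ b_γ^k × I = ∅` -/
  cond5 : ∀ i : ℕ, k + 1 ≤ i → i ≤ S.m →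
      (∀ j ∈ Finset.Icc 1 S.n, j ∉ T.ml → Disjoint (G.bd (va i)) (wa j)) ∧
      ∀ γ ∈ T.ml, Disjoint (G.bd (va i)) (T.band γ)

namespace Prop1Data

variable {G : GeomPrim X} {S : GordonSetup X G} {k : ℕ}

/-- `w_j^k − ∪_{γ<j} int b_γ^k × I` intersects `v_i^k` in exactly one point
(Definition 2.3.2). -/
def Meets1 (P : Prop1Data G S k) (i j : ℕ) : Prop :=
  ∃ p : X, (P.wa j \ ⋃ γ ∈ P.T.ml.filter (· < j), P.T.innerBand γ) ∩ P.va i = {p}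

/-- `L(w_j^k)`. -/
def Lw (P : Prop1Data G S k) (j : ℕ) : Set ℕ :=
  {i | k + 1 ≤ i ∧ i ≤ S.m ∧ P.Meets1 i j}

/-- `L(v_i^k)`. -/
def Lv (P : Prop1Data G S k) (i : ℕ) : Set ℕ :=
  {j | j ∈ Finset.Icc 1 S.n ∧ j ∉ P.T.ml ∧ P.Meets1 i j}

end Prop1Data

/-- The data and conditions of **Proposition 4** at stage `k` : a surface
`F^k ⊆ ∂₊𝒱₋` generated by an abstract tree `∪_f E_f^k ∪_{γ ∈ m(k)} e_γ^k`, together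
with the pairwise disjoint arcs `c_i^k` (`k+1 ≤ i ≤ m`) and `d_j^k`
(`j ∈ {1,…,n} − m(k)`) in `F^k` satisfying conditions (1)–(5) of Proposition 4. -/
structure Prop4Data {X : Type*} [TopologicalSpace X] (G : GeomPrim X)
    (S : GordonSetup X G) (k : ℕ) where
  /-- the abstract tree `∪_f E_f^k ∪_{γ∈m(k)} e_γ^k` with `m(k) = T.ml`, whose
  generated surface is `F^k = T.total` -/
  T : TreeConfig X G
  hk : T.k = k
  hn : T.n = S.n
  card_le : T.ml.card ≤ k
  gen : T.Generates
  sub : T.total ⊆ G.plusBd S.Vm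
  /-- the arcs `c_i^k` -/
  ca : ℕ → Set X
  /-- the arcs `d_j^k` -/
  da : ℕ → Set X
  ca_sub : ∀ i : ℕ, k + 1 ≤ i → i ≤ S.m → ca i ⊆ T.total
  da_sub : ∀ j ∈ Finset.Icc 1 S.n, j ∉ T.ml → da j ⊆ T.total
  ca_disj : ∀ i : ℕ, k + 1 ≤ i → i ≤ S.m → ∀ i' : ℕ, k + 1 ≤ i' → i' ≤ S.m →
      i ≠ i' → Disjoint (ca i) (ca i')
  da_disj : ∀ j ∈ Finset.Icc 1 S.n, j ∉ T.ml → ∀ j' ∈ Finset.Icc 1 S.n, j' ∉ T.ml →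
      j ≠ j' → Disjoint (da j) (da j')
  /-- condition (1)(i) : for `λ ∈ m(k)` with `s(w_λ) = −`,
  `(int e_λ^k × I) ∩ (∪_{γ<λ} e_γ^k × I ∪_f E_f^k) = ∪_{r ∈ I(w_λ,k)} (d_r^k × I)_λ` -/
  cond_i : ∀ l ∈ T.ml, S.sw l = false →
      T.innerBand l ∩ T.below l = ⋃ r ∈ S.IwS l T.ml, G.subProd (T.band l) (da r)
  /-- condition (1)(ii) : for `λ ∈ m(k)` with `s(w_λ) = +`, `int e_λ^k × I` is
  disjoint from `∪_f E_f^k ∪_{γ<λ} e_γ^k × I` -/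
  cond_ii : ∀ l ∈ T.ml, S.sw l = true → Disjoint (T.innerBand l) (T.below l)
  /-- condition (2) : `d_j^k` is regular in `∪_{γ<j} e_γ^k × I ∪_f E_f^k` -/
  cond2 : ∀ j ∈ Finset.Icc 1 S.n, j ∉ T.ml → T.RegularIn (T.ml.filter (· < j)) (da j)
  /-- condition (3) -/
  cond3 : ∀ j ∈ Finset.Icc 1 S.n, j ∉ T.ml → ∀ γ ∈ T.ml, j < γ →
      (j ∈ S.IwS γ T.ml ∧ S.sw γ = false) ∨ Disjoint (da j) (T.band γ)
  /-- condition (4), first part -/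
  cond4 : ∀ i : ℕ, k + 1 ≤ i → i ≤ S.m →
      G.ProperArcIn T.total (ca i) ∧ ∃ f ≤ T.k, ca i ⊆ T.P f
  /-- condition (4), second part -/
  cond4' : ∀ i : ℕ, k + 1 ≤ i → i ≤ S.m → ∀ j ∈ Finset.Icc 1 S.n, j ∉ T.ml →
      ((da j \ ⋃ γ ∈ T.ml.filter (· < j), T.innerBand γ) ∩ ca i).Subsingleton
  /-- condition (5) -/
  cond5 : ∀ i : ℕ, k + 1 ≤ i → i ≤ S.m →
      (∀ j ∈ Finset.Icc 1 S.n, j ∉ T.ml → Disjoint (G.bd (ca i)) (da j)) ∧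
      ∀ γ ∈ T.ml, Disjoint (G.bd (ca i)) (T.band γ)

namespace Prop4Data

variable {G : GeomPrim X} {S : GordonSetup X G} {k : ℕ}

/-- `d_j^k − ∪_{γ<j} int e_γ^k × I` intersects `c_i^k` in exactly one point
(Definition 2.3.3). -/
def Meets1 (P : Prop4Data G S k) (i j : ℕ) : Prop :=
  ∃ p : X, (P.da j \ ⋃ γ ∈ P.T.ml.filter (· < j), P.T.innerBand γ) ∩ P.ca i = {p}

/-- `L(d_j^k)`. -/
def Ld (P : Prop4Data G S k) (j : ℕ) : Set ℕ :=
  {i | k + 1 ≤ i ∧ i ≤ S.m ∧ P.Meets1 i j}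

/-- `L(c_i^k)`. -/
def Lc (P : Prop4Data G S k) (i : ℕ) : Set ℕ :=
  {j | j ∈ Finset.Icc 1 S.n ∧ j ∉ P.T.ml ∧ P.Meets1 i j}

end Prop4Data

/-- The disks of **Proposition 3** at stage `k` : pairwise disjoint disks
`V_i^k` (`k+1 ≤ i ≤ m`, `s(v_i) = +`) and `V_x^k` properly embedded in `𝒱₊`, and
`W_j^k` (`j ∈ {1,…,n} − m(k)`, `s(w_j) = +`) and `W_x^k` properly embedded in `𝒲₊`,
with the intersection conditions (1) and (2) of Proposition 3. -/
structure Prop3Data {X : Type*} [TopologicalSpace X] (G : GeomPrim X)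
    (S : GordonSetup X G) (k : ℕ) (P : Prop1Data G S k) where
  /-- the disks `V_i^k` -/
  VDk : ℕ → Set X
  /-- the disk `V_x^k` -/
  Vxk : Set X
  /-- the disks `W_j^k` -/
  WDk : ℕ → Set X
  /-- the disk `W_x^k` -/
  Wxk : Set X
  VD_proper : ∀ i : ℕ, k + 1 ≤ i → i ≤ S.m → S.sv i = true →
      G.ProperDiskIn S.Vp (VDk i)
  Vx_proper : G.ProperDiskIn S.Vp Vxk
  WD_proper : ∀ j ∈ Finset.Icc 1 S.n, j ∉ P.T.ml → S.sw j = true →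
      G.ProperDiskIn S.Wp (WDk j)
  Wx_proper : G.ProperDiskIn S.Wp Wxk
  VD_disj : ∀ i : ℕ, k + 1 ≤ i → i ≤ S.m → S.sv i = true →
      ∀ i' : ℕ, k + 1 ≤ i' → i' ≤ S.m → S.sv i' = true → i ≠ i' →
        Disjoint (VDk i) (VDk i')
  VDx_disj : ∀ i : ℕ, k + 1 ≤ i → i ≤ S.m → S.sv i = true → Disjoint (VDk i) Vxk
  WD_disj : ∀ j ∈ Finset.Icc 1 S.n, j ∉ P.T.ml → S.sw j = true →
      ∀ j' ∈ Finset.Icc 1 S.n, j' ∉ P.T.ml → S.sw j' = true → j ≠ j' →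
        Disjoint (WDk j) (WDk j')
  WDx_disj : ∀ j ∈ Finset.Icc 1 S.n, j ∉ P.T.ml → S.sw j = true →
      Disjoint (WDk j) Wxk
  /-- condition (1) : `V_i^k ∩ P^k = v_i^k ∪_{r ∈ I(v_i,k)} v_r^k` -/
  inter1 : ∀ i : ℕ, k + 1 ≤ i → i ≤ S.m → S.sv i = true →
      VDk i ∩ P.T.total = P.va i ∪ ⋃ r ∈ S.IvS i k, P.va r
  /-- condition (1) : `W_j^k ∩ P^k = w_j^k ∪_{r ∈ I(w_j,k)} w_r^k` -/
  inter2 : ∀ j ∈ Finset.Icc 1 S.n, j ∉ P.T.ml → S.sw j = true →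
      WDk j ∩ P.T.total = P.wa j ∪ ⋃ r ∈ S.IwS j P.T.ml, P.wa r
  /-- condition (1) : `V_x^k ∩ P^k = ∪_{r ∈ I(v,k)} v_r^k` -/
  inter3 : Vxk ∩ P.T.total = ⋃ r ∈ S.IvxS k, P.va r
  /-- condition (1) : `W_x^k ∩ P^k = ∪_{r ∈ I(w,k)} w_r^k` -/
  inter4 : Wxk ∩ P.T.total = ⋃ r ∈ S.IwxS P.T.ml, P.wa r
  /-- condition (2) : `V_i^k ∩ W_j^k = V_i^k ∩ W_j^k ∩ P^k` -/
  meet1 : ∀ i : ℕ, k + 1 ≤ i → i ≤ S.m → S.sv i = true →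
      ∀ j ∈ Finset.Icc 1 S.n, j ∉ P.T.ml → S.sw j = true →
        VDk i ∩ WDk j = VDk i ∩ WDk j ∩ P.T.total
  /-- condition (2) : `V_i^k ∩ W_x^k = V_i^k ∩ W_x^k ∩ P^k` -/
  meet2 : ∀ i : ℕ, k + 1 ≤ i → i ≤ S.m → S.sv i = true →
      VDk i ∩ Wxk = VDk i ∩ Wxk ∩ P.T.total
  /-- condition (2) : `V_x^k ∩ W_j^k = V_x^k ∩ W_j^k ∩ P^k` -/
  meet3 : ∀ j ∈ Finset.Icc 1 S.n, j ∉ P.T.ml → S.sw j = true →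
      Vxk ∩ WDk j = Vxk ∩ WDk j ∩ P.T.total
  /-- condition (2) : `V_x^k ∩ W_x^k = (V_x^k ∩ W_x^k ∩ P^k) ∪ {x}` -/
  meet4 : Vxk ∩ Wxk = (Vxk ∩ Wxk ∩ P.T.total) ∪ {S.x}

/-- The disks of **Proposition 6** at stage `k` : pairwise disjoint disks
`V_i^k` (`k+1 ≤ i ≤ m`, `s(v_i) = −`) properly embedded in `𝒱₋` and `W_j^k`
(`j ∈ {1,…,n} − m(k)`, `s(w_j) = −`) properly embedded in `𝒲₋`, with the
intersection conditions (1) and (2) of Proposition 6. -/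
structure Prop6Data {X : Type*} [TopologicalSpace X] (G : GeomPrim X)
    (S : GordonSetup X G) (k : ℕ) (P : Prop4Data G S k) where
  /-- the disks `V_i^k` -/
  VDk : ℕ → Set X
  /-- the disks `W_j^k` -/
  WDk : ℕ → Set X
  VD_proper : ∀ i : ℕ, k + 1 ≤ i → i ≤ S.m → S.sv i = false →
      G.ProperDiskIn S.Vm (VDk i)
  WD_proper : ∀ j ∈ Finset.Icc 1 S.n, j ∉ P.T.ml → S.sw j = false →
      G.ProperDiskIn S.Wm (WDk j)
  VD_disj : ∀ i : ℕ, k + 1 ≤ i → i ≤ S.m → S.sv i = false →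
      ∀ i' : ℕ, k + 1 ≤ i' → i' ≤ S.m → S.sv i' = false → i ≠ i' →
        Disjoint (VDk i) (VDk i')
  WD_disj : ∀ j ∈ Finset.Icc 1 S.n, j ∉ P.T.ml → S.sw j = false →
      ∀ j' ∈ Finset.Icc 1 S.n, j' ∉ P.T.ml → S.sw j' = false → j ≠ j' →
        Disjoint (WDk j) (WDk j')
  /-- condition (1) : `V_i^k ∩ F^k = c_i^k ∪_{r ∈ I(v_i,k)} c_r^k` -/
  inter1 : ∀ i : ℕ, k + 1 ≤ i → i ≤ S.m → S.sv i = false →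
      VDk i ∩ P.T.total = P.ca i ∪ ⋃ r ∈ S.IvS i k, P.ca r
  /-- condition (1) : `W_j^k ∩ F^k = d_j^k ∪_{r ∈ I(w_j,k)} d_r^k` -/
  inter2 : ∀ j ∈ Finset.Icc 1 S.n, j ∉ P.T.ml → S.sw j = false →
      WDk j ∩ P.T.total = P.da j ∪ ⋃ r ∈ S.IwS j P.T.ml, P.da r
  /-- condition (2) : `V_i^k ∩ W_j^k = V_i^k ∩ W_j^k ∩ F^k` -/
  meet : ∀ i : ℕ, k + 1 ≤ i → i ≤ S.m → S.sv i = false →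
      ∀ j ∈ Finset.Icc 1 S.n, j ∉ P.T.ml → S.sw j = false →
        VDk i ∩ WDk j = VDk i ∩ WDk j ∩ P.T.total

/-- A coherent family of the data of Propositions 1 and 4 for all stages `k ≤ l`,
together with the selection `m^k` of the new index adjoined at each stage
(`msel k = none` when `m^k = ∅`), so that `m(0) = ∅` and
`m(k+1) = m(k) ∪ {m^{k+1}}`, with the same `m(k)` used for `P^k` and `F^k`. -/
structure Tower {X : Type*} [TopologicalSpace X] (G : GeomPrim X)
    (S : GordonSetup X G) (l : ℕ) where
  P1 : (k : ℕ) → k ≤ l → Prop1Data G S k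
  P4 : (k : ℕ) → k ≤ l → Prop4Data G S k
  /-- the element `m^k` adjoined at stage `k` (`none` when `m^k = ∅`) -/
  msel : ℕ → Option ℕ
  msel_zero : msel 0 = none
  ml_zero : (P1 0 (Nat.zero_le l)).T.ml = ∅
  ml_succ : ∀ (k : ℕ) (h : k + 1 ≤ l), (P1 (k + 1) h).T.ml =
      (P1 k (Nat.le_of_succ_le h)).T.ml ∪ (msel (k + 1)).toFinset
  ml_eq : ∀ (k : ℕ) (h : k ≤ l), (P4 k h).T.ml = (P1 k h).T.ml

namespace Tower

variable {G : GeomPrim X} {S : GordonSetup X G} {l : ℕ}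

/-- the Proposition-1 data at stage `k − 1`. -/
def prev (Tw : Tower G S l) (k : ℕ) (hk : k ≤ l) : Prop1Data G S (k - 1) :=
  Tw.P1 (k - 1) (le_trans (Nat.sub_le k 1) hk)

/-- the Proposition-4 data at stage `k − 1`. -/
def prev4 (Tw : Tower G S l) (k : ℕ) (hk : k ≤ l) : Prop4Data G S (k - 1) :=
  Tw.P4 (k - 1) (le_trans (Nat.sub_le k 1) hk)

/-- The conclusion of **Proposition 2** for the tower : for `1 ≤ k ≤ l` and
`j ∈ {1,…,n} − m(k)`, (1) if `j ∉ L(v_k^{k−1})` then `L(w_j^k) = L(w_j^{k−1})`;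
(2) if `j ∈ L(v_k^{k−1})` then `L(w_j^k)` is the symmetric difference of
`L(w_j^{k−1})` and `L(w_{m^k}^{k−1})`; and (3) `m⁰ = ∅` and
`m^k = Min L(c_k^{k−1})`. -/
def Prop2Holds (Tw : Tower G S l) : Prop :=
  Tw.msel 0 = none ∧
  ∀ (k : ℕ), 1 ≤ k → ∀ hk : k ≤ l,
    (∀ j ∈ Finset.Icc 1 S.n, j ∉ (Tw.P1 k hk).T.ml →
      (j ∉ (Tw.prev k hk).Lv k → (Tw.P1 k hk).Lw j = (Tw.prev k hk).Lw j) ∧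
      (j ∈ (Tw.prev k hk).Lv k → ∀ mk : ℕ, Tw.msel k = some mk →
        (Tw.P1 k hk).Lw j =
          ((Tw.prev k hk).Lw j ∪ (Tw.prev k hk).Lw mk) \
            ((Tw.prev k hk).Lw j ∩ (Tw.prev k hk).Lw mk))) ∧
    (((Tw.prev4 k hk).Lc k = ∅ → Tw.msel k = none) ∧
      ∀ _hne : ((Tw.prev4 k hk).Lc k).Nonempty,
        Tw.msel k = some (sInf ((Tw.prev4 k hk).Lc k)))

/-- The conclusion of **Proposition 5** for the tower : `L(c_i^0) = L(v_i^0)` and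
`L(d_j^0) = L(w_j^0)`, and for `1 ≤ k ≤ l` and `j ∉ m(k)`, (1) if
`j ∉ L(c_k^{k−1})` then `L(d_j^k) = L(d_j^{k−1})`; (2) if `j ∈ L(c_k^{k−1})` then
`L(d_j^k)` is the symmetric difference of `L(d_j^{k−1})` and `L(d_{m^k}^{k−1})`. -/
def Prop5Holds (Tw : Tower G S l) : Prop :=
  ((∀ i : ℕ, (Tw.P4 0 (Nat.zero_le l)).Lc i = (Tw.P1 0 (Nat.zero_le l)).Lv i) ∧
    ∀ j : ℕ, (Tw.P4 0 (Nat.zero_le l)).Ld j = (Tw.P1 0 (Nat.zero_le l)).Lw j) ∧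
  ∀ (k : ℕ), 1 ≤ k → ∀ hk : k ≤ l, ∀ j ∈ Finset.Icc 1 S.n, j ∉ (Tw.P1 k hk).T.ml →
    (j ∉ (Tw.prev4 k hk).Lc k → (Tw.P4 k hk).Ld j = (Tw.prev4 k hk).Ld j) ∧
    (j ∈ (Tw.prev4 k hk).Lc k → ∀ mk : ℕ, Tw.msel k = some mk →
      (Tw.P4 k hk).Ld j =
        ((Tw.prev4 k hk).Ld j ∪ (Tw.prev4 k hk).Ld mk) \
          ((Tw.prev4 k hk).Ld j ∩ (Tw.prev4 k hk).Ld mk))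

end Tower

namespace Tower

variable {G : GeomPrim X} {S : GordonSetup X G} {l : ℕ}

/-- At a fixed stage, `L(v_i) = L(c_i)` for all `i` follows from `L(d_j) = L(w_j)` for all `j`. -/
theorem Lv_eq_Lc_of_Ld_eq_Lw (Tw : Tower G S l) {k : ℕ} (hk : k ≤ l)
    (h : ∀ j ∈ Finset.Icc 1 S.n, j ∉ (Tw.P1 k hk).T.ml → (Tw.P4 k hk).Ld j = (Tw.P1 k hk).Lw j)
    {i : ℕ} (hi : k + 1 ≤ i) (him : i ≤ S.m) :
    (Tw.P1 k hk).Lv i = (Tw.P4 k hk).Lc i := by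
  ext j
  simp only [Prop1Data.Lv, Prop4Data.Lc, Set.mem_ofPred_eq, Tw.ml_eq k hk]
  refine and_congr_right fun hj => and_congr_right fun hjm => ?_
  have hmem := Set.ext_iff.1 (h j hj (Tw.ml_eq k hk ▸ hjm)) i
  simp only [Prop1Data.Lw, Prop4Data.Ld, Set.mem_ofPred_eq, hi, him, true_and] at hmem
  exact hmem.symm

/-- `L(d_j^k) = L(w_j^k)` at every stage `k ≤ l` of the tower. -/
theorem Ld_eq_Lw (Tw : Tower G S l) (hl : l ≤ S.m) (h2 : Tw.Prop2Holds) (h5 : Tw.Prop5Holds) :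
    ∀ (k : ℕ) (hk : k ≤ l), ∀ j ∈ Finset.Icc 1 S.n, j ∉ (Tw.P1 k hk).T.ml →
      (Tw.P4 k hk).Ld j = (Tw.P1 k hk).Lw j := by
  intro k
  induction k with
  | zero => exact fun _ j _ _ => h5.1.2 j
  | succ k ih =>
    intro hk j hj hjm
    have ihk := ih (Nat.le_of_succ_le hk)
    obtain ⟨hw, -, hsel⟩ := h2.2 (k + 1) k.succ_pos hk
    obtain ⟨hw₁, hw₂⟩ := hw j hj hjm
    obtain ⟨hd₁, hd₂⟩ := h5.2 (k + 1) k.succ_pos hk j hj hjm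
    have hL : (Tw.prev (k + 1) hk).Lv (k + 1) = (Tw.prev4 (k + 1) hk).Lc (k + 1) :=
      Tw.Lv_eq_Lc_of_Ld_eq_Lw (Nat.le_of_succ_le hk) ihk le_rfl (hk.trans hl)
    have hjk : j ∉ (Tw.P1 k (Nat.le_of_succ_le hk)).T.ml := fun hmem =>
      hjm (Tw.ml_succ k hk ▸ Finset.mem_union_left _ hmem)
    have hj_eq : (Tw.prev4 (k + 1) hk).Ld j = (Tw.prev (k + 1) hk).Lw j := ihk j hj hjk
    by_cases hjL : j ∈ (Tw.prev4 (k + 1) hk).Lc (k + 1)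
    · have hmin := Nat.sInf_mem ⟨j, hjL⟩
      have hmsel := hsel ⟨j, hjL⟩
      have hm_eq : (Tw.prev4 (k + 1) hk).Ld (sInf ((Tw.prev4 (k + 1) hk).Lc (k + 1))) =
          (Tw.prev (k + 1) hk).Lw (sInf ((Tw.prev4 (k + 1) hk).Lc (k + 1))) :=
        ihk _ hmin.1 (Tw.ml_eq k (Nat.le_of_succ_le hk) ▸ hmin.2.1)
      rw [hd₂ hjL _ hmsel, hw₂ (hL ▸ hjL) _ hmsel, hj_eq, hm_eq]
    · rw [hd₁ hjL, hw₁ (hL ▸ hjL), hj_eq]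

end Tower

/-- **Lemma 3.1.5** : assume the conclusions of Propositions 1–6 hold for all
`k ≤ l`.  Then `L(v_i^l) = L(c_i^l)` for each `i`, and `L(d_j^l) = L(w_j^l)` for
each `j`. -/
theorem L_sets_agree (G : GeomPrim X) (S : GordonSetup X G) (l : ℕ) (hl : l ≤ S.m)
    (Tw : Tower G S l)
    (h2 : Tw.Prop2Holds) (h5 : Tw.Prop5Holds)
    (h3 : ∀ (k : ℕ) (h : k ≤ l), Nonempty (Prop3Data G S k (Tw.P1 k h)))
    (h6 : ∀ (k : ℕ) (h : k ≤ l), Nonempty (Prop6Data G S k (Tw.P4 k h))) :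
    (∀ i : ℕ, l + 1 ≤ i → i ≤ S.m →
        (Tw.P1 l le_rfl).Lv i = (Tw.P4 l le_rfl).Lc i) ∧
    (∀ j ∈ Finset.Icc 1 S.n, j ∉ (Tw.P1 l le_rfl).T.ml →
        (Tw.P4 l le_rfl).Ld j = (Tw.P1 l le_rfl).Lw j) := by
  have hdw := Tw.Ld_eq_Lw hl h2 h5 l le_rfl
  exact ⟨fun _ hi him => Tw.Lv_eq_Lc_of_Ld_eq_Lw le_rfl hdw hi him, hdw⟩
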